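/- arXiv:math/0305286 — 3 statements merged into one kernel-verified Lean document; each statement's English description precedes it below -/
import Mathlib

section
/- (F-adjunction, purely F-regular case.) Let (R, m) be an F-finite regular local ring of prime characteristic p > 0 and I ⊊ R an unmixed reduced ideal of height h > 0. Let a₁,…,a_k be ideals of R with I ⊆ a_i for all i = 1,…,k, and let t₁,…,t_k > 0 be real numbers; write S = R/I. If the pair (R, I^h·a₁^{t₁}⋯a_k^{t_k}) (the pair with ideals I, a₁,…,a_k and exponents h, t₁,…,t_k) is purely F-regular, then the pair (S, (a₁S)^{t₁}⋯(a_kS)^{t_k}) is strongly F-regular. -/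
/-!  Common definitions: F-singularities of pairs `(R, a₁^{t₁} ⋯ a_k^{t_k})`
(Takagi, "F-singularities of pairs and Inversion of Adjunction of arbitrary
codimension"). -/

/-- The subring of `p`-th powers of `R`. -/
def pthPowers (R : Type*) [CommRing R] (p : ℕ) : Subring R :=
  Subring.closure (Set.range fun x : R => x ^ p)

/-- `R` is F-finite: it is a finitely generated module over its subring of `p`-th powers. -/
def FFinite (R : Type*) [CommRing R] (p : ℕ) : Prop :=
  Module.Finite (pthPowers R p) R

/-- `c^{1/q} R → R^{1/q}` splits as an `R`-module homomorphism: there is an additive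
map `φ : R → R` with `φ (a ^ q * x) = a * φ x` for all `a x` and `φ c = 1`. -/
def SplitsAlong (R : Type*) [CommRing R] (c : R) (q : ℕ) : Prop :=
  ∃ φ : R →+ R, (∀ a x : R, φ (a ^ q * x) = a * φ x) ∧ φ c = 1

/-- Membership in `R°`: `c` lies in no minimal prime of `R`. -/
def NotInMinimalPrimes (R : Type*) [CommRing R] (c : R) : Prop :=
  ∀ P ∈ minimalPrimes R, c ∉ P

/-- F-purity of the pair `(R, a₁^{t₁} ⋯ a_k^{t_k})`: for all sufficiently large
`q = p^e` there is `d ∈ a₁^{⌊t₁(q-1)⌋} ⋯ a_k^{⌊t_k(q-1)⌋}` such that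
`d^{1/q} R → R^{1/q}` splits. -/
def FPurePair (R : Type*) [CommRing R] (p : ℕ) {k : ℕ}
    (a : Fin k → Ideal R) (t : Fin k → ℝ) : Prop :=
  ∃ e₀ : ℕ, ∀ e : ℕ, e₀ ≤ e →
    ∃ d ∈ ∏ i, a i ^ ⌊t i * ((p ^ e : ℝ) - 1)⌋₊, SplitsAlong R d (p ^ e)

/-- Strong F-regularity of the pair `(R, a₁^{t₁} ⋯ a_k^{t_k})`: for every `c ∈ R°`
there are `q = p^e` and `d ∈ a₁^{⌊t₁(q-1)⌋} ⋯ a_k^{⌊t_k(q-1)⌋}` such that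
`(cd)^{1/q} R → R^{1/q}` splits. -/
def StronglyFRegularPair (R : Type*) [CommRing R] (p : ℕ) {k : ℕ}
    (a : Fin k → Ideal R) (t : Fin k → ℝ) : Prop :=
  ∀ c : R, NotInMinimalPrimes R c →
    ∃ e : ℕ, ∃ d ∈ ∏ i, a i ^ ⌊t i * ((p ^ e : ℝ) - 1)⌋₊, SplitsAlong R (c * d) (p ^ e)

/-- Pure F-regularity of the pair `(R, a₁^{t₁} ⋯ a_k^{t_k})`: for every `c ∈ R°` not
in any minimal prime of `a₁ ⋯ a_k`, for all sufficiently large `q = p^e` there is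
`d ∈ a₁^{⌊t₁(q-1)⌋} ⋯ a_k^{⌊t_k(q-1)⌋}` such that `(cd)^{1/q} R → R^{1/q}` splits. -/
def PurelyFRegularPair (R : Type*) [CommRing R] (p : ℕ) {k : ℕ}
    (a : Fin k → Ideal R) (t : Fin k → ℝ) : Prop :=
  ∀ c : R, NotInMinimalPrimes R c → (∀ P ∈ (∏ i, a i).minimalPrimes, c ∉ P) →
    ∃ e₀ : ℕ, ∀ e : ℕ, e₀ ≤ e →
      ∃ d ∈ ∏ i, a i ^ ⌊t i * ((p ^ e : ℝ) - 1)⌋₊, SplitsAlong R (c * d) (p ^ e)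

/-- A strongly F-regular ring: for every `c ∈ R°` there is `q = p^e` such that
`c^{1/q} R → R^{1/q}` splits. -/
def StronglyFRegularRing (R : Type*) [CommRing R] (p : ℕ) : Prop :=
  ∀ c : R, NotInMinimalPrimes R c → ∃ e : ℕ, SplitsAlong R c (p ^ e)

/-- The Frobenius power `J^{[q]}`, the ideal generated by `q`-th powers of elements
of `J`. -/
def frobeniusPower {R : Type*} [CommRing R] (J : Ideal R) (q : ℕ) : Ideal R :=
  Ideal.span ((fun x => x ^ q) '' (J : Set R))

/-- A regular local ring: a Noetherian local ring whose maximal ideal is generated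
by `dim R` elements. -/
def IsRegularLocal (R : Type*) [CommRing R] [IsLocalRing R] : Prop :=
  IsNoetherianRing R ∧
    ∃ s : Finset R, Ideal.span (s : Set R) = IsLocalRing.maximalIdeal R ∧
      (s.card : WithBot ℕ∞) = ringKrullDim R

/-- The height of a prime ideal. -/
noncomputable def primeHeight {R : Type*} [CommRing R] (P : Ideal R) (hP : P.IsPrime) : ℕ∞ :=
  Order.height (⟨P, hP⟩ : PrimeSpectrum R)

/-- `I` is an unmixed reduced ideal of height `h`: `I` is radical and every minimal
prime of `I` has height `h`. -/
def UnmixedReducedOfHeight {R : Type*} [CommRing R] (I : Ideal R) (h : ℕ) : Prop :=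
  I.IsRadical ∧ ∀ (P : Ideal R) (hP : P.IsPrime), P ∈ I.minimalPrimes →
    primeHeight P hP = (h : ℕ∞)

open MonomialOrder in
/-- The ideal generated by the monomials in `y` that are strictly larger than the one with
exponent `α` for the degree-lexicographic order. -/
noncomputable def largerMonomials {A : Type*} [CommRing A] {r : ℕ} (y : Fin r → A)
    (α : Fin r →₀ ℕ) : Ideal A :=
  Ideal.span ((fun β : Fin r →₀ ℕ => ∏ i, y i ^ β i) ''
    {β | degLex.toSyn α < degLex.toSyn β})

theorem length_quotient_add_one_le {A : Type*} [CommRing A] {K K' : Ideal A} (h : K < K') :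
    Module.length A (A ⧸ K') + 1 ≤ Module.length A (A ⧸ K) := by
  rw [Module.length_quotient, Module.length_quotient]
  exact Order.coheight_add_one_le h

theorem length_quotient_sup_mul_le {A : Type*} [CommRing A] (J : Ideal A) (a b : A) :
    Module.length A (A ⧸ J ⊔ Ideal.span {a * b}) ≤
      Module.length A (A ⧸ J ⊔ Ideal.span {a}) + Module.length A (A ⧸ J ⊔ Ideal.span {b}) := by
  have hle : J ⊔ Ideal.span {a * b} ≤ J ⊔ Ideal.span {a} :=
    sup_le_sup_left ((Ideal.span_singleton_le_span_singleton).2 (dvd_mul_right a b)) _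
  let g : (A ⧸ J ⊔ Ideal.span {a * b}) →ₗ[A] (A ⧸ J ⊔ Ideal.span {a}) := Submodule.factor hle
  let f : (A ⧸ J ⊔ Ideal.span {b}) →ₗ[A] (A ⧸ J ⊔ Ideal.span {a * b}) :=
    Submodule.mapQ _ _ (LinearMap.mulLeft A a) <| by
      rw [sup_le_iff]
      refine ⟨fun x hx => Ideal.mem_sup_left (J.mul_mem_left a hx), ?_⟩
      rw [Ideal.span_le, Set.singleton_subset_iff]
      exact Ideal.mem_sup_right (Ideal.mem_span_singleton_self _)
  have hg : Function.Surjective g := Submodule.factor_surjective hle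
  have hker : LinearMap.ker g ≤ LinearMap.range f := by
    intro x hx
    obtain ⟨x, rfl⟩ := Submodule.mkQ_surjective _ x
    have hx' : x ∈ J ⊔ Ideal.span {a} := by
      exact Ideal.Quotient.eq_zero_iff_mem.1 hx
    obtain ⟨j, hj, z, hz, rfl⟩ := Submodule.mem_sup.1 hx'
    obtain ⟨w, rfl⟩ := Ideal.mem_span_singleton'.1 hz
    refine ⟨Submodule.Quotient.mk w, ?_⟩
    change Submodule.Quotient.mk (a * w) = Submodule.Quotient.mk (j + w * a)
    rw [Submodule.Quotient.eq]
    have : a * w - (j + w * a) = -j := by ring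
    rw [this]
    exact Ideal.mem_sup_left (J.neg_mem hj)
  rw [Module.length_eq_add_of_exact (LinearMap.ker g).subtype g (Submodule.subtype_injective _) hg
    (LinearMap.exact_subtype_ker_map g), add_comm]
  gcongr
  exact (Module.length_le_of_injective _ (Submodule.inclusion_injective hker)).trans
    (Module.length_le_of_surjective f.rangeRestrict f.surjective_rangeRestrict)

theorem length_quotient_sup_pow_le {A : Type*} [CommRing A] (J : Ideal A) (a : A) (n : ℕ) :
    Module.length A (A ⧸ J ⊔ Ideal.span {a ^ n}) ≤
      n * Module.length A (A ⧸ J ⊔ Ideal.span {a}) := by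
  induction n with
  | zero =>
    have : Subsingleton (A ⧸ J ⊔ Ideal.span {a ^ 0}) := by
      rw [Ideal.Quotient.subsingleton_iff]
      simp
    rw [Module.length_eq_zero]
    exact zero_le
  | succ n ih =>
    rw [pow_succ]
    refine (length_quotient_sup_mul_le J (a ^ n) a).trans ?_
    push_cast
    rw [add_mul, one_mul]
    gcongr

theorem length_quotient_sup_span_pow_le {A : Type*} [CommRing A] (s : Finset A) (n : ℕ)
    (J : Ideal A) :
    Module.length A (A ⧸ J ⊔ Ideal.span ((· ^ n) '' (s : Set A))) ≤
      (n : ℕ∞) ^ s.card * Module.length A (A ⧸ J ⊔ Ideal.span (s : Set A)) := by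
  classical
  induction s using Finset.induction_on generalizing J with
  | empty => rw [Finset.coe_empty, Set.image_empty]; simp
  | insert a s ha ih =>
    have h₁ : J ⊔ Ideal.span ((· ^ n) '' ((insert a s : Finset A) : Set A)) =
        J ⊔ Ideal.span {a ^ n} ⊔ Ideal.span ((· ^ n) '' (s : Set A)) := by
      rw [Finset.coe_insert, Set.image_insert_eq, Ideal.span_insert, sup_assoc]
    have h₂ : J ⊔ Ideal.span ((insert a s : Finset A) : Set A) =
        J ⊔ Ideal.span (s : Set A) ⊔ Ideal.span {a} := by
      rw [Finset.coe_insert, Ideal.span_insert, sup_assoc, sup_comm (Ideal.span {a})]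
    rw [Finset.card_insert_of_notMem ha, h₁, h₂, pow_succ, mul_assoc]
    refine (ih _).trans ?_
    rw [sup_right_comm]
    exact mul_le_mul_right (length_quotient_sup_pow_le _ a n) _

section Monomials

open MonomialOrder

variable {A : Type*} [CommRing A] {r : ℕ} (y : Fin r → A)

theorem prod_pow_add (α β : Fin r →₀ ℕ) :
    ∏ i, y i ^ (α + β) i = (∏ i, y i ^ α i) * ∏ i, y i ^ β i := by
  simp [pow_add, Finset.prod_mul_distrib]

theorem degLex_lt_of_degree_lt {α β : Fin r →₀ ℕ} (h : α.degree < β.degree) :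
    degLex.toSyn α < degLex.toSyn β := by
  rw [degLex_lt_iff, Finsupp.DegLex.lt_iff]
  exact Or.inl h

theorem degree_le_of_degLex_lt {α β : Fin r →₀ ℕ} (h : degLex.toSyn α < degLex.toSyn β) :
    α.degree ≤ β.degree :=
  not_lt.1 fun h' => lt_asymm h (degLex_lt_of_degree_lt h')

theorem mem_largerMonomials_of_le {α β : Fin r →₀ ℕ} (h : α ≤ β)
    (hα : ∏ i, y i ^ α i ∈ largerMonomials y α) : ∏ i, y i ^ β i ∈ largerMonomials y β := by
  obtain ⟨γ, rfl⟩ := exists_add_of_le h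
  have key : ∀ x ∈ largerMonomials y α,
      x * ∏ i, y i ^ γ i ∈ largerMonomials y (α + γ) := by
    intro x hx
    induction hx using Submodule.span_induction with
    | mem x hx =>
      obtain ⟨δ, hδ, rfl⟩ := hx
      refine Ideal.subset_span ⟨δ + γ, ?_, prod_pow_add y δ γ⟩
      simpa using hδ
    | zero => simp
    | add x z _ _ hx hz => rw [add_mul]; exact add_mem hx hz
    | smul a x _ hx => rw [smul_mul_assoc]; exact Submodule.smul_mem _ a hx
  rw [prod_pow_add]
  exact key _ hα

theorem span_range_pow_le_span_monomials (n : ℕ) :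
    Ideal.span (Set.range y) ^ n ≤
      Ideal.span ((fun β : Fin r →₀ ℕ => ∏ i, y i ^ β i) '' {β | β.degree = n}) := by
  induction n with
  | zero =>
    rw [pow_zero, Ideal.one_eq_top, top_le_iff, Ideal.eq_top_iff_one]
    exact Ideal.subset_span ⟨0, by simp, by simp⟩
  | succ n ih =>
    rw [pow_succ]
    refine (Ideal.mul_mono_left ih).trans ?_
    rw [Ideal.span_mul_span', Ideal.span_le]
    rintro _ ⟨_, ⟨β, hβ, rfl⟩, _, ⟨j, rfl⟩, rfl⟩
    refine Ideal.subset_span ⟨β + Finsupp.single j 1, ?_, ?_⟩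
    · simpa using hβ
    · change ∏ i, y i ^ ((β + Finsupp.single j 1 : Fin r →₀ ℕ) i) = (∏ i, y i ^ β i) * y j
      rw [prod_pow_add]
      congr 1
      rw [Finset.prod_eq_single j (fun i _ hij => by simp [Finsupp.single_eq_of_ne hij])
        (by simp)]
      simp

theorem card_le_length_quotient (T : Finset (Fin r →₀ ℕ)) :
    (∀ α ∈ T, ∏ i, y i ^ α i ∉ largerMonomials y α) →
    ∀ K : Ideal A, (∀ α ∈ T, K ≤ largerMonomials y α) →
      (T.card : ℕ∞) ≤ Module.length A (A ⧸ K) := by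
  classical
  refine Finset.induction_on_max_value (fun α => degLex.toSyn α) T (fun _ _ _ => by simp) ?_
  intro α T hα hmax ih hT K hK
  let K' := K ⊔ Ideal.span {∏ i, y i ^ α i}
  have hlt : K < K' := by
    refine lt_of_le_of_ne le_sup_left fun h => hT α (Finset.mem_insert_self _ _) ?_
    refine hK α (Finset.mem_insert_self _ _) ?_
    rw [h]
    exact Ideal.mem_sup_right (Ideal.mem_span_singleton_self _)
  have hK' : ∀ β ∈ T, K' ≤ largerMonomials y β := by
    intro β hβ
    refine sup_le (hK β (Finset.mem_insert_of_mem hβ)) ?_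
    rw [Ideal.span_le, Set.singleton_subset_iff]
    have hne : degLex.toSyn β ≠ degLex.toSyn α := fun h => hα (degLex.toSyn.injective h ▸ hβ)
    exact Ideal.subset_span ⟨α, lt_of_le_of_ne (hmax β hβ) hne, rfl⟩
  rw [Finset.card_insert_of_notMem hα]
  push_cast
  refine le_trans ?_ (length_quotient_add_one_le hlt)
  gcongr
  exact ih (fun β hβ => hT β (Finset.mem_insert_of_mem hβ)) K' hK'

theorem span_range_pow_le_largerMonomials {α : Fin r →₀ ℕ} {n : ℕ} (h : α.degree < n) :
    Ideal.span (Set.range y) ^ n ≤ largerMonomials y α := by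
  refine (span_range_pow_le_span_monomials y n).trans (Ideal.span_mono (Set.image_mono ?_))
  rintro β rfl
  exact degLex_lt_of_degree_lt h

/-- The exponent of a monomial which is not in the ideal of larger monomials has at most
`s.card` large entries, where `s` generates an ideal of finite colength `L`. -/
theorem card_filter_le_of_notMem_largerMonomials (s : Finset A)
    (hs : Ideal.span (s : Set A) ≤ Ideal.span (Set.range y)) (L : ℕ)
    (hL : Module.length A (A ⧸ Ideal.span (s : Set A)) ≤ L) {β : Fin r →₀ ℕ}
    (hβ : ∏ i, y i ^ β i ∉ largerMonomials y β) :
    (Finset.univ.filter fun i => (s.card + 1) ^ s.card * L + 1 ≤ β i).card ≤ s.card := by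
  set h := s.card
  set K := (h + 1) ^ h * L + 1 with hKdef
  by_contra! hlt
  obtain ⟨S, hS, hScard⟩ := Finset.exists_subset_card_eq (Nat.succ_le_of_lt hlt)
  let T : Finset (Fin r →₀ ℕ) := S.finsupp fun _ => Finset.range K
  let n := (h + 1) * K
  have hTcard : T.card = K ^ (h + 1) := by
    simp [T, Finset.card_finsupp, hScard]
  have hTle : ∀ α ∈ T, α ≤ β := by
    intro α hα i
    rw [Finset.mem_finsupp_iff] at hα
    by_cases hi : i ∈ S
    · have h₁ := Finset.mem_range.1 (hα.2 i hi)
      have h₂ := (Finset.mem_filter.1 (hS hi)).2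
      exact h₁.le.trans h₂
    · rw [Finsupp.notMem_support_iff.1 fun h => hi (hα.1 h)]
      exact Nat.zero_le _
  have hTdeg : ∀ α ∈ T, α.degree < n := by
    intro α hα
    rw [Finset.mem_finsupp_iff] at hα
    calc α.degree ≤ ∑ i ∈ S, α i := by
          rw [Finsupp.degree_apply]
          exact Finset.sum_le_sum_of_subset hα.1
      _ < ∑ _i ∈ S, K := Finset.sum_lt_sum_of_nonempty
          (Finset.card_pos.1 (by omega)) fun i hi => Finset.mem_range.1 (hα.2 i hi)
      _ = n := by simp [hScard, n]
  have hpow : Ideal.span ((· ^ n) '' (s : Set A)) ≤ Ideal.span (Set.range y) ^ n := by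
    rw [Ideal.span_le]
    rintro _ ⟨x, hx, rfl⟩
    exact Ideal.pow_mem_pow (hs (Ideal.subset_span hx)) n
  have h₁ := card_le_length_quotient y T
    (fun α hα hmem => hβ (mem_largerMonomials_of_le y (hTle α hα) hmem)) _
    fun α hα => hpow.trans (span_range_pow_le_largerMonomials y (hTdeg α hα))
  have h₂ := length_quotient_sup_span_pow_le s n ⊥
  rw [bot_sup_eq, bot_sup_eq] at h₂
  have h₃ : ((K ^ (h + 1) : ℕ) : ℕ∞) ≤ ((n ^ h * L : ℕ) : ℕ∞) := by
    rw [← hTcard]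
    refine h₁.trans (h₂.trans ?_)
    push_cast
    gcongr
  have h₄ : K ^ (h + 1) ≤ n ^ h * L := by exact_mod_cast h₃
  have h₅ : K ^ h * K ≤ K ^ h * ((h + 1) ^ h * L) := by
    calc K ^ h * K = K ^ (h + 1) := (pow_succ _ _).symm
      _ ≤ n ^ h * L := h₄
      _ = K ^ h * ((h + 1) ^ h * L) := by simp only [n, mul_pow]; ring
  have h₆ := Nat.le_of_mul_le_mul_left h₅ (pow_pos (by omega) h)
  omega

theorem exists_pow_le_span_range_pow (s : Finset A)
    (hs : Ideal.span (s : Set A) ≤ Ideal.span (Set.range y))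
    (hL : Module.length A (A ⧸ Ideal.span (s : Set A)) ≠ ⊤) :
    ∃ C, ∀ Q, Ideal.span (Set.range y) ^ (s.card * Q + C) ≤
      Ideal.span (Set.range fun i => y i ^ Q) := by
  obtain ⟨L, hL⟩ := ENat.ne_top_iff_exists.1 hL
  set K := (s.card + 1) ^ s.card * L + 1 with hK
  refine ⟨r * K + 1, fun Q => ?_⟩
  set q := Ideal.span (Set.range fun i => y i ^ Q)
  have hdvd : ∀ β : Fin r →₀ ℕ, ∏ i, y i ^ β i ∉ q → ∀ i, β i < Q := by
    intro β hβ i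
    by_contra! hi
    refine hβ (Ideal.mem_of_dvd _ ?_ (Ideal.subset_span ⟨i, rfl⟩))
    exact (pow_dvd_pow _ hi).trans (Finset.dvd_prod_of_mem _ (Finset.mem_univ i))
  have key : ∀ β : Fin r →₀ ℕ, β.degree = s.card * Q + (r * K + 1) → ∏ i, y i ^ β i ∈ q := by
    by_contra! hbad
    let B : Set (Fin r →₀ ℕ) := {β | s.card * Q + (r * K + 1) ≤ β.degree ∧ ∏ i, y i ^ β i ∉ q}
    have hBfin : B.Finite := by
      refine (Finsupp.finite_of_degree_le (r * Q)).subset fun β hβ => ?_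
      change β.degree ≤ r * Q
      rw [Finsupp.degree_eq_sum]
      refine (Finset.sum_le_card_nsmul _ _ Q fun i _ => (hdvd β hβ.2 i).le).trans ?_
      simp
    have hBne : B.Nonempty := by
      obtain ⟨β, hβ, hβ'⟩ := hbad
      exact ⟨β, hβ.ge, hβ'⟩
    obtain ⟨β, hβ, hmax⟩ := hBfin.exists_maximalFor (fun α => degLex.toSyn α) B hBne
    have hstd : ∏ i, y i ^ β i ∉ largerMonomials y β := by
      intro hmem
      refine hβ.2 ((Ideal.span_le.2 ?_ : largerMonomials y β ≤ q) hmem)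
      rintro _ ⟨γ, hγ, rfl⟩
      by_contra hγq
      exact (not_le.2 hγ) (hmax ⟨hβ.1.trans (degree_le_of_degLex_lt hγ), hγq⟩ hγ.le)
    have hcard := card_filter_le_of_notMem_largerMonomials y s hs L hL.ge hstd
    have hQ := hdvd β hβ.2
    rw [← hK] at hcard
    have hsum : β.degree < s.card * Q + (r * K + 1) := by
      rw [Finsupp.degree_eq_sum]
      have hle : ∑ i, β i ≤ ∑ i, ((if K ≤ β i then Q else 0) + K) := by
        refine Finset.sum_le_sum fun i _ => ?_
        have := hQ i
        split_ifs <;> omega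
      rw [Finset.sum_add_distrib, ← Finset.sum_filter, Finset.sum_const, Finset.sum_const,
        Finset.card_univ, Fintype.card_fin, smul_eq_mul, smul_eq_mul] at hle
      have := Nat.mul_le_mul_right Q hcard
      omega
    exact absurd hβ.1 hsum.not_ge
  refine (span_range_pow_le_span_monomials y _).trans ?_
  rw [Ideal.span_le]
  rintro _ ⟨β, hβ, rfl⟩
  exact key β hβ

end Monomials

/-- In a Noetherian ring, powers of a prime `P` of height `h` are asymptotically contained in the
ideals `P^{[Q]}`, locally at `P`. -/
theorem exists_forall_pow_mul_mem_frobeniusPower {R : Type*} [CommRing R] [IsNoetherianRing R]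
    (P : Ideal R) [P.IsPrime] (h : ℕ) (hP : P.height = h) :
    ∃ C, ∀ Q, ∀ z ∈ P ^ (h * Q + C), ∃ s ∉ P, s * z ∈ frobeniusPower P Q := by
  let A := Localization.AtPrime P
  obtain ⟨r, x, hx⟩ := Submodule.fg_iff_exists_fin_generating_family.1
    (IsNoetherian.noetherian P)
  let y : Fin r → A := fun i => algebraMap R A (x i)
  have hmap : ∀ n, (P ^ n).map (algebraMap R A) = IsLocalRing.maximalIdeal A ^ n := fun n => by
    rw [Ideal.map_pow, Localization.AtPrime.map_eq_maximalIdeal]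
  have hy : Ideal.span (Set.range y) = IsLocalRing.maximalIdeal A := by
    calc Ideal.span (Set.range y) = (Ideal.span (Set.range x)).map (algebraMap R A) := by
          rw [Ideal.map_span, ← Set.range_comp]
          rfl
      _ = P.map (algebraMap R A) := congrArg _ hx
      _ = _ := Localization.AtPrime.map_eq_maximalIdeal
  have hm : (IsLocalRing.maximalIdeal A).height = h := by
    rw [← hP, ← WithBot.coe_inj, IsLocalRing.maximalIdeal_height_eq_ringKrullDim,
      IsLocalization.AtPrime.ringKrullDim_eq_height P A]
  obtain ⟨s, hs, hcard⟩ :=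
    Ideal.exists_finset_card_eq_height_of_isNoetherianRing (IsLocalRing.maximalIdeal A)
  obtain rfl : s.card = h := by exact_mod_cast hcard.trans hm
  have hart := IsLocalRing.quotient_artinian_of_mem_minimalPrimes_of_isLocalRing _ hs
  have hL : Module.length A (A ⧸ Ideal.span (s : Set A)) ≠ ⊤ := by
    have : IsArtinian A (A ⧸ Ideal.span (s : Set A)) :=
      isArtinian_of_surjective_algebraMap
        (Ideal.Quotient.mk_surjective (I := Ideal.span (s : Set A)))
    exact Module.length_ne_top
  obtain ⟨C, hC⟩ := exists_pow_le_span_range_pow y s (hy ▸ hs.1.2) hL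
  refine ⟨C, fun Q z hz => ?_⟩
  have hle : Ideal.span (Set.range fun i => y i ^ Q) ≤
      (frobeniusPower P Q).map (algebraMap R A) := by
    rw [Ideal.span_le]
    rintro _ ⟨i, rfl⟩
    change (algebraMap R A (x i)) ^ Q ∈ _
    rw [← map_pow]
    refine Ideal.mem_map_of_mem _ (Ideal.subset_span ⟨x i, ?_, rfl⟩)
    exact hx ▸ Submodule.subset_span ⟨i, rfl⟩
  have hz' : algebraMap R A z ∈ (frobeniusPower P Q).map (algebraMap R A) := by
    refine hle (hC Q ?_)
    rw [hy, ← hmap]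
    exact Ideal.mem_map_of_mem _ hz
  obtain ⟨t, ht, htz⟩ := (IsLocalization.algebraMap_mem_map_algebraMap_iff P.primeCompl A _ _).1 hz'
  exact ⟨t, ht, htz⟩

theorem map_mem_of_mem_frobeniusPower {R : Type*} [CommRing R] {q : ℕ} {φ : R →+ R}
    (hφ : ∀ a x : R, φ (a ^ q * x) = a * φ x) {P : Ideal R} {z : R}
    (hz : z ∈ frobeniusPower P q) : φ z ∈ P := by
  rw [frobeniusPower] at hz
  have key : ∀ c : R, φ (c * z) ∈ P := by
    induction hz using Submodule.span_induction with
    | mem x hx =>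
      obtain ⟨x, hx, rfl⟩ := hx
      intro c
      change φ (c * x ^ q) ∈ P
      rw [mul_comm, hφ]
      exact P.mul_mem_right _ hx
    | zero => simp
    | add x z _ _ hx hz =>
      intro c
      rw [mul_add, map_add]
      exact add_mem (hx c) (hz c)
    | smul a x _ hx =>
      intro c
      rw [smul_eq_mul, ← mul_assoc]
      exact hx _
  simpa using key 1

/-- If a `q⁻¹`-linear map `φ` satisfies `φ x ∉ P` for some `x ∈ I ^ (h (q - 1) + 1)`, its `n`-th
iterate sends some element of `I ^ (h (q ^ n - 1) + n)` outside of `P`. -/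
theorem exists_iterate_notMem {R : Type*} [CommRing R] {q h : ℕ} (hq : 0 < q) {φ : R →+ R}
    (hφ : ∀ a x : R, φ (a ^ q * x) = a * φ x) {P I : Ideal R} [P.IsPrime] {x : R}
    (hx : x ∈ I ^ (h * (q - 1) + 1)) (hxP : φ x ∉ P) (n : ℕ) :
    ∃ ψ : R →+ R, (∀ a z : R, ψ (a ^ q ^ n * z) = a * ψ z) ∧
      ∃ z ∈ I ^ (h * (q ^ n - 1) + n), ψ z ∉ P := by
  induction n with
  | zero =>
    refine ⟨AddMonoidHom.id R, by simp, 1, by simp, ?_⟩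
    exact (Ideal.ne_top_iff_one P).1 Ideal.IsPrime.ne_top'
  | succ n ih =>
    obtain ⟨ψ, hψ, z, hz, hzP⟩ := ih
    obtain ⟨m, hm⟩ : ∃ m, q ^ n = m + 1 := Nat.exists_eq_succ_of_ne_zero (pow_pos hq n).ne'
    refine ⟨ψ.comp φ, fun a w => ?_, (φ x) ^ (m * q) * (z ^ q * x), ?_, ?_⟩
    · rw [AddMonoidHom.comp_apply, pow_succ, pow_mul, hφ, hψ]
      rfl
    · have hzx := Ideal.mul_mem_mul (Ideal.pow_mem_pow hz q) hx
      rw [← pow_mul, ← pow_add] at hzx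
      refine Ideal.mul_mem_left _ _ (Ideal.pow_le_pow_right ?_ hzx)
      obtain ⟨q, rfl⟩ := Nat.exists_eq_succ_of_ne_zero hq.ne'
      rw [pow_succ (q.succ), hm, Nat.succ_eq_add_one]
      have h₁ : (m + 1) * (q + 1) - 1 = m * (q + 1) + q := by
        rw [add_mul, one_mul]; omega
      rw [h₁, Nat.add_sub_cancel, Nat.add_sub_cancel]
      nlinarith [Nat.zero_le (n * q)]
    · rw [AddMonoidHom.comp_apply, pow_mul, hφ, hφ]
      have : (φ x) ^ m * (z * φ x) = (φ x) ^ q ^ n * z := by rw [hm]; ring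
      rw [this, hψ]
      exact fun hmem => (Ideal.IsPrime.mem_or_mem ‹_› hmem).elim hxP hzP

/-- A `q⁻¹`-linear map sends `I ^ (h (q - 1) + 1)` into the height `h` prime ideals containing
`I`. -/
theorem map_mem_of_mem_pow {R : Type*} [CommRing R] [IsNoetherianRing R] {q h : ℕ} (hq : 0 < q)
    {φ : R →+ R} (hφ : ∀ a x : R, φ (a ^ q * x) = a * φ x) {P I : Ideal R} [P.IsPrime]
    (hP : P.height = h) (hIP : I ≤ P) {x : R} (hx : x ∈ I ^ (h * (q - 1) + 1)) : φ x ∈ P := by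
  by_contra hxP
  obtain ⟨C, hC⟩ := exists_forall_pow_mul_mem_frobeniusPower P h hP
  obtain ⟨ψ, hψ, z, hz, hzP⟩ := exists_iterate_notMem hq hφ hx hxP (h + C)
  obtain ⟨m, hm⟩ : ∃ m, q ^ (h + C) = m + 1 :=
    Nat.exists_eq_succ_of_ne_zero (pow_pos hq _).ne'
  have hexp : h * (q ^ (h + C) - 1) + (h + C) = h * q ^ (h + C) + C := by
    rw [hm, Nat.add_sub_cancel]; ring
  rw [hexp] at hz
  obtain ⟨s, hs, hsz⟩ := hC _ z (Ideal.pow_right_mono hIP _ hz)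
  have hmem : s ^ q ^ (h + C) * z ∈ frobeniusPower P (q ^ (h + C)) := by
    have : s ^ q ^ (h + C) * z = s ^ m * (s * z) := by rw [hm]; ring
    rw [this]
    exact Ideal.mul_mem_left _ _ hsz
  have := map_mem_of_mem_frobeniusPower hψ hmem
  rw [hψ] at this
  exact (Ideal.IsPrime.mem_or_mem ‹_› this).elim hs hzP

/-- If `I` is contained in no minimal prime of `R`, every class modulo `I` has a representative
outside of the minimal primes of `R`. -/
theorem exists_sub_mem_and_notInMinimalPrimes {R : Type*} [CommRing R] [IsNoetherianRing R]
    (I : Ideal R) (hI : ∀ P ∈ minimalPrimes R, ¬ I ≤ P) (c : R) :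
    ∃ d : R, d - c ∈ I ∧ NotInMinimalPrimes R d := by
  classical
  have hfin := minimalPrimes.finite_of_isNoetherianRing R
  set M := hfin.toFinset
  have hM : ∀ P, P ∈ M ↔ P ∈ minimalPrimes R := fun P => hfin.mem_toFinset
  let J : Ideal R := I * ∏ P ∈ M.filter (c ∉ ·), P
  have hJ : ¬ (J : Set R) ⊆ ⋃ P ∈ ((M.filter (c ∈ ·) : Finset (Ideal R)) : Set (Ideal R)), P := by
    rw [Ideal.subset_union_prime (f := fun P : Ideal R => P) ⊥ ⊥
      fun P hP _ _ => ((hM P).1 (Finset.mem_filter.1 hP).1).1.1]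
    rintro ⟨P, hP, hle⟩
    obtain ⟨hPM, hcP⟩ := Finset.mem_filter.1 hP
    have hPmin := (hM P).1 hPM
    have := hPmin.1.1
    rcases (Ideal.IsPrime.mul_le this).1 hle with h | h
    · exact hI P hPmin h
    · obtain ⟨Q, hQ, hQP⟩ := (Ideal.IsPrime.prod_le this).1 h
      obtain ⟨hQM, hcQ⟩ := Finset.mem_filter.1 hQ
      have hQmin := (hM Q).1 hQM
      exact hcQ (hPmin.2 hQmin.1 hQP hcP)
  obtain ⟨z, hz, hzM⟩ := Set.not_subset.1 hJ
  refine ⟨c + z, by simpa using Ideal.mul_le_left hz, fun P hP hmem => ?_⟩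
  by_cases hc : c ∈ P
  · refine hzM (Set.mem_biUnion (Finset.mem_coe.2 (Finset.mem_filter.2 ⟨(hM P).2 hP, hc⟩)) ?_)
    exact (Ideal.add_mem_iff_right P hc).1 hmem
  · refine hc ((Ideal.add_mem_iff_left P ?_).1 hmem)
    have hzP := Ideal.mul_le_right hz
    exact Ideal.prod_le_inf.trans (Finset.inf_le (Finset.mem_filter.2 ⟨(hM P).2 hP, hc⟩)) hzP

/-- A `q⁻¹`-linear endomorphism preserving `I` and sending `c` to a unit yields a splitting on
`R ⧸ I`. -/
theorem splitsAlong_quotient {R : Type*} [CommRing R] {q : ℕ} {φ : R →+ R}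
    (hφ : ∀ a x : R, φ (a ^ q * x) = a * φ x) {I : Ideal R} (hI : ∀ x ∈ I, φ x ∈ I) {c : R}
    (hc : IsUnit (φ c)) : SplitsAlong (R ⧸ I) (Ideal.Quotient.mk I c) q := by
  obtain ⟨u, hu⟩ := hc
  let ψ : R ⧸ I →+ R ⧸ I := QuotientAddGroup.map I.toAddSubgroup I.toAddSubgroup φ hI
  have hψ : ∀ x, ψ (Ideal.Quotient.mk I x) = Ideal.Quotient.mk I (φ x) := fun x => rfl
  refine ⟨(AddMonoidHom.mulLeft (Ideal.Quotient.mk I (↑u⁻¹ : R))).comp ψ, ?_, ?_⟩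
  · intro a x
    obtain ⟨a, rfl⟩ := Ideal.Quotient.mk_surjective a
    obtain ⟨x, rfl⟩ := Ideal.Quotient.mk_surjective x
    rw [← map_pow, ← map_mul, AddMonoidHom.comp_apply, AddMonoidHom.comp_apply, hψ, hψ, hφ,
      map_mul, AddMonoidHom.coe_mulLeft]
    ring
  · rw [AddMonoidHom.comp_apply, hψ, AddMonoidHom.coe_mulLeft, ← map_mul, ← hu, Units.inv_mul,
      map_one]

/-- F-adjunction, purely F-regular case. Suppose `I ⊆ aᵢ` for all `i`.
If `(R, I^h a₁^{t₁} ⋯ a_k^{t_k})` is purely F-regular, then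
`(S, (a₁S)^{t₁} ⋯ (a_kS)^{t_k})` is strongly F-regular. -/
theorem fAdjunction_purelyFRegular {R : Type*} [CommRing R] [IsLocalRing R] (p : ℕ)
    [Fact p.Prime] [CharP R p] (hreg : IsRegularLocal R) (hFF : FFinite R p)
    (I : Ideal R) (hIne : I ≠ ⊤) (h : ℕ) (hh : 0 < h)
    (hI : UnmixedReducedOfHeight I h) {k : ℕ}
    (a : Fin k → Ideal R) (hIa : ∀ i, I ≤ a i)
    (t : Fin k → ℝ) (ht : ∀ i, 0 < t i)
    (hR : PurelyFRegularPair R p (Fin.cons I a) (Fin.cons (h : ℝ) t)) :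
    StronglyFRegularPair (R ⧸ I) p (fun i => (a i).map (Ideal.Quotient.mk I)) t := by
  have hnoeth := hreg.1
  have hheight : ∀ P ∈ I.minimalPrimes, P.height = h := by
    intro P hP
    have hprime := hP.1.1
    rw [← hI.2 P hprime hP, primeHeight, ← PrimeSpectrum.height_eq_orderHeight]
  intro c hc
  obtain ⟨c₀, rfl⟩ := Ideal.Quotient.mk_surjective c
  obtain ⟨c, hcc, hc'⟩ := exists_sub_mem_and_notInMinimalPrimes I (fun P hP hle => by
    have := hP.1.1
    have hPI : P ∈ I.minimalPrimes := ⟨⟨this, hle⟩, fun Q hQ hQP => hP.2 ⟨hQ.1, bot_le⟩ hQP⟩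
    have h0 := hheight P hPI
    rw [Ideal.height_eq_zero_iff.2 hP] at h0
    exact hh.ne (by exact_mod_cast h0)) c₀
  have hcI : ∀ P ∈ I.minimalPrimes, c ∉ P := by
    rw [Ideal.minimalPrimes_eq_comap]
    rintro _ ⟨P, hP, rfl⟩ hmem
    rw [Ideal.mem_comap, Ideal.Quotient.eq.2 hcc] at hmem
    exact hc P hP hmem
  rw [← Ideal.Quotient.eq.2 hcc]
  obtain ⟨e, he⟩ := hR c hc' <| by
    rintro P ⟨⟨hP, hle⟩, hmin⟩
    have hIP : I ≤ P := by
      obtain ⟨i, -, hi⟩ := (Ideal.IsPrime.prod_le hP).1 hle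
      refine Fin.cases (fun hi => hi) (fun i hi => (hIa i).trans hi) i hi
    have hprod : ∏ i, (Fin.cons I a : Fin (k + 1) → Ideal R) i ≤ I := by
      rw [Fin.prod_univ_succ]
      exact Ideal.mul_le_left
    refine hcI P ⟨⟨hP, hIP⟩, fun Q hQ hQP => hmin ⟨hQ.1, hprod.trans hQ.2⟩ hQP⟩
  obtain ⟨d, hd, φ, hφ, hφd⟩ := he e le_rfl
  have hq : 0 < p ^ e := pow_pos (Fact.out : p.Prime).pos e
  set T := ∏ i, a i ^ ⌊t i * ((p ^ e : ℝ) - 1)⌋₊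
  have hd' : d ∈ I ^ (h * (p ^ e - 1)) * T := by
    have hfloor : ⌊(h : ℝ) * ((p ^ e : ℝ) - 1)⌋₊ = h * (p ^ e - 1) := by
      rw [← Nat.floor_natCast (R := ℝ) (h * (p ^ e - 1))]
      push_cast [Nat.cast_sub (Nat.one_le_iff_ne_zero.2 hq.ne')]
      rfl
    rw [Fin.prod_univ_succ] at hd
    simpa only [Fin.cons_zero, Fin.cons_succ, hfloor] using hd
  obtain ⟨x, hx, y, hy, hu⟩ :
      ∃ x ∈ I ^ (h * (p ^ e - 1)), ∃ y ∈ T, IsUnit (φ (x * (c * y))) := by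
    by_contra! hno
    have hmem : φ (c * d) ∈ IsLocalRing.maximalIdeal R := by
      clear hφd hd
      induction hd' using Submodule.mul_induction_on' with
      | mem_mul_mem x hx y hy =>
        have := hno x hx y hy
        rwa [mul_left_comm] at this
      | add x _ y _ hx hy =>
        rw [mul_add, map_add]
        exact add_mem hx hy
    rw [hφd] at hmem
    exact (IsLocalRing.maximalIdeal.isMaximal R).ne_top ((Ideal.eq_top_iff_one _).2 hmem)
  refine ⟨e, Ideal.Quotient.mk I y, ?_, ?_⟩
  · simp only [← Ideal.map_pow]
    have hmap := map_prod (Ideal.mapHom (Ideal.Quotient.mk I))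
      (fun i => a i ^ ⌊t i * ((p ^ e : ℝ) - 1)⌋₊) Finset.univ
    exact hmap.le (Ideal.mem_map_of_mem _ hy)
  · rw [← map_mul]
    refine splitsAlong_quotient (φ := φ.comp (AddMonoidHom.mulLeft x)) (fun b z => ?_)
      (fun z hz => ?_) hu
    · rw [AddMonoidHom.comp_apply, AddMonoidHom.comp_apply, AddMonoidHom.coe_mulLeft,
        mul_left_comm, hφ]
    · rw [AddMonoidHom.comp_apply, AddMonoidHom.coe_mulLeft, ← hI.1.radical,
        ← Ideal.sInf_minimalPrimes, Submodule.mem_sInf]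
      intro P hP
      have := hP.1.1
      refine map_mem_of_mem_pow hq hφ (hheight P hP) hP.1.2 ?_
      rw [pow_succ]
      exact Ideal.mul_mem_mul hx hz
end

section
/- Let (R, m) be an F-finite regular local ring of prime characteristic p > 0 and let I ⊊ R be an unmixed reduced ideal of height h > 0. Then for every power q = p^e one has (I^{[q]} : I) ⊆ I^{q−1}. -/
section

open IsLocalRing RingTheory.Sequence TensorProduct

section RegularSystem

theorem ringKrullDim_le_length_of_ofList_eq_maximalIdeal {R : Type*} [CommRing R] [IsLocalRing R]
    [IsNoetherianRing R] {xs : List R} (hxs : Ideal.ofList xs = maximalIdeal R) :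
    ringKrullDim R ≤ xs.length := by
  classical
  refine (ringKrullDim_le_spanFinrank_maximalIdeal R).trans ?_
  rw [← hxs]
  have hs : {x : R | x ∈ xs} = (xs.toFinset : Set R) := by ext; simp
  have h1 := Submodule.spanFinrank_span_le_ncard_of_finite (R := R)
    (xs.toFinset.finite_toSet)
  rw [Set.ncard_coe_finset] at h1
  have h2 := h1.trans xs.toFinset_card_le
  unfold Ideal.ofList
  rw [hs]
  exact_mod_cast h2

/-- A prime principal ideal that is not a minimal prime forces a Noetherian local ring to be a
domain. -/
theorem isDomain_of_isPrime_span_singleton {R : Type*} [CommRing R] [IsLocalRing R]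
    [IsNoetherianRing R] {y : R} (hprime : (Ideal.span {y}).IsPrime)
    (hmin : Ideal.span {y} ∉ minimalPrimes R) : IsDomain R := by
  obtain ⟨P, hP, hle⟩ := Ideal.exists_minimalPrimes_le (bot_le (a := Ideal.span {y}))
  have hPp : P.IsPrime := hP.1.1
  have hy : y ∉ P := fun hy => hmin <| by
    rwa [show Ideal.span {y} = P from
      le_antisymm ((Ideal.span_singleton_le_iff_mem P).2 hy) hle]
  have hPbot : P = ⊥ := by
    refine Submodule.eq_bot_of_le_smul_of_le_jacobson_bot (Ideal.span {y}) P
      (IsNoetherian.noetherian P) (fun z hz => ?_) ?_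
    · obtain ⟨w, rfl⟩ := Ideal.mem_span_singleton'.1 (hle hz)
      have hw : w ∈ P := (hPp.mem_or_mem hz).resolve_right hy
      rw [mul_comm]
      exact Submodule.smul_mem_smul (Ideal.mem_span_singleton_self y) hw
    · exact (le_maximalIdeal hprime.ne_top).trans (maximalIdeal_le_jacobson ⊥)
  rw [hPbot] at hPp
  exact IsDomain.of_bot_isPrime R

theorem isDomain_of_forall_isPrime_span_singleton {R : Type*} [CommRing R]
    [IsLocalRing R] [IsNoetherianRing R] {x : R} {xs : List R}
    (hx : Ideal.ofList (x :: xs) = maximalIdeal R)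
    (hdim : ((xs.length + 1 : ℕ) : WithBot ℕ∞) ≤ ringKrullDim R)
    (hprime : ∀ y, Ideal.ofList (y :: xs) = maximalIdeal R → (Ideal.span {y}).IsPrime) :
    IsDomain R := by
  by_contra hdom
  have hmin : ∀ y, Ideal.ofList (y :: xs) = maximalIdeal R →
      Ideal.span {y} ∈ minimalPrimes R := fun y hy => by
    by_contra h
    exact hdom (isDomain_of_isPrime_span_singleton (hprime y hy) h)
  cases xs with
  | nil =>
    have h1 := hmin x hx
    rw [Ideal.ofList_singleton] at hx
    rw [hx, ← Ideal.height_eq_zero_iff] at h1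
    rw [← maximalIdeal_height_eq_ringKrullDim, h1] at hdim
    exact absurd hdim (by simp)
  | cons z zs =>
    have hgen : ∀ k : ℕ, Ideal.ofList ((x + z ^ (k + 1)) :: z :: zs) = maximalIdeal R := by
      intro k
      rw [← hx]
      simp only [Ideal.ofList_cons, ← sup_assoc]
      congr 1
      have hz : ∀ w : R, z ^ (k + 1) ∈ Ideal.span {w} ⊔ Ideal.span {z} := fun w =>
        Ideal.mem_sup_right (Ideal.mem_span_singleton.2 (dvd_pow_self z k.succ_ne_zero))
      apply le_antisymm
      · refine sup_le ((Ideal.span_singleton_le_iff_mem _).2 ?_) le_sup_right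
        exact add_mem (Ideal.mem_sup_left (Ideal.mem_span_singleton_self x)) (hz x)
      · refine sup_le ((Ideal.span_singleton_le_iff_mem _).2 ?_) le_sup_right
        have := sub_mem (Ideal.mem_sup_left (T := Ideal.span {z})
          (Ideal.mem_span_singleton_self (x + z ^ (k + 1)))) (hz (x + z ^ (k + 1)))
        simpa using this
    obtain ⟨k, l, hkl, heq⟩ : ∃ k l : ℕ, k < l ∧
        Ideal.span {x + z ^ (k + 1)} = Ideal.span {x + z ^ (l + 1)} := by
      have := (minimalPrimes.finite_of_isNoetherianRing R).to_subtype
      obtain ⟨a, b, hab, h⟩ := Finite.exists_ne_map_eq_of_infinite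
        (fun k : ℕ => (⟨_, hmin _ (hgen k)⟩ : minimalPrimes R))
      have h' := congrArg Subtype.val h
      rcases lt_or_gt_of_ne hab with h1 | h1
      · exact ⟨a, b, h1, h'⟩
      · exact ⟨b, a, h1, h'.symm⟩
    have hP := hprime _ (hgen k)
    set P := Ideal.span {x + z ^ (k + 1)} with hPdef
    have hxk : x + z ^ (k + 1) ∈ P := Ideal.mem_span_singleton_self _
    have hxl : x + z ^ (l + 1) ∈ P := heq ▸ Ideal.mem_span_singleton_self _
    have hzm : z ∈ maximalIdeal R := hx ▸ Ideal.subset_span (by simp)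
    have hunit : IsUnit (1 - z ^ (l - k)) :=
      isUnit_one_sub_self_of_mem_nonunits _
        (Ideal.pow_mem_of_mem _ hzm _ (Nat.sub_pos_of_lt hkl))
    have hzP : z ∈ P := by
      refine hP.mem_of_pow_mem (k + 1) ?_
      rw [← Ideal.unit_mul_mem_iff_mem P hunit]
      have : (1 - z ^ (l - k)) * z ^ (k + 1) = (x + z ^ (k + 1)) - (x + z ^ (l + 1)) := by
        rw [show l + 1 = (l - k) + (k + 1) by omega, pow_add]; ring
      rw [this]
      exact sub_mem hxk hxl
    have hdrop : Ideal.ofList ((x + z ^ (k + 1)) :: zs) = maximalIdeal R := by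
      rw [← hgen k]
      simp only [Ideal.ofList_cons, ← sup_assoc]
      rw [sup_eq_left.2 ((Ideal.span_singleton_le_iff_mem _).2 hzP)]
    have := hdim.trans (ringKrullDim_le_length_of_ofList_eq_maximalIdeal hdrop)
    simp only [List.length_cons, Nat.cast_le] at this
    omega

/-- A Noetherian local ring whose maximal ideal is generated by `dim R` elements is a domain, and
these elements form a regular sequence. -/
theorem isDomain_and_isWeaklyRegular_of_ofList_eq_maximalIdeal (n : ℕ) :
    ∀ {R : Type*} [CommRing R] [IsLocalRing R] [IsNoetherianRing R] (xs : List R),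
      xs.length = n → Ideal.ofList xs = maximalIdeal R → (n : WithBot ℕ∞) ≤ ringKrullDim R →
      IsDomain R ∧ IsWeaklyRegular R xs := by
  induction n with
  | zero =>
    intro R _ _ _ xs hn hxs _
    obtain rfl := List.length_eq_zero_iff.1 hn
    rw [Ideal.ofList_nil] at hxs
    exact ⟨(isField_iff_maximalIdeal_eq.2 hxs.symm).isDomain, .nil R R⟩
  | succ n ih =>
    intro R _ _ _ xs hn hxs hdim
    obtain ⟨x, xs, rfl⟩ := List.exists_cons_of_length_eq_add_one hn
    have hn' : xs.length = n := by simpa using hn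
    have quot : ∀ y, Ideal.ofList (y :: xs) = maximalIdeal R →
        IsDomain (R ⧸ Ideal.span {y}) ∧
          IsWeaklyRegular (R ⧸ Ideal.span {y}) (xs.map (Ideal.Quotient.mk (Ideal.span {y}))) := by
      intro y hy
      have hym : y ∈ maximalIdeal R := hy ▸ Ideal.subset_span (by simp)
      have : Nontrivial (R ⧸ Ideal.span {y}) := Ideal.Quotient.nontrivial_iff.2 fun h =>
        (maximalIdeal.isMaximal R).ne_top
          (top_le_iff.1 (h ▸ (Ideal.span_singleton_le_iff_mem _).2 hym))
      have : IsLocalRing (R ⧸ Ideal.span {y}) :=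
        .of_surjective' (Ideal.Quotient.mk _) Ideal.Quotient.mk_surjective
      refine ih _ (by simpa using hn') ?_ ?_
      · rw [← map_maximalIdeal_of_surjective (Ideal.Quotient.mk (Ideal.span {y}))
          Ideal.Quotient.mk_surjective, ← hy, Ideal.map_ofList, List.map_cons, Ideal.ofList_cons]
        simp
      · have h1 := (maximalIdeal_height_eq_ringKrullDim (R := R)) ▸
          Ideal.height_le_ringKrullDim_quotient_add_one hym
        have h2 := hdim.trans h1
        push_cast at h2
        exact (ENat.WithBot.add_le_add_natCast_right_iff (c := 1)).1 (by simpa using h2)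
    have hdom : IsDomain R := isDomain_of_forall_isPrime_span_singleton hxs (hn' ▸ hdim)
      fun y hy => (Ideal.Quotient.isDomain_iff_prime _).1 (quot y hy).1
    refine ⟨hdom, ?_⟩
    have hx0 : x ≠ 0 := by
      rintro rfl
      have : Ideal.ofList xs = maximalIdeal R := by rw [← hxs]; simp
      have := hdim.trans (ringKrullDim_le_length_of_ofList_eq_maximalIdeal this)
      rw [hn', Nat.cast_le] at this
      omega
    refine .cons' (fun a b h => mul_left_cancel₀ hx0 h) ?_
    have e : QuotSMulTop x R ≃ₗ[R ⧸ Ideal.span {x}] (R ⧸ Ideal.span {x}) :=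
      (Submodule.quotEquivOfEq _ _ <| by
        rw [← Submodule.ideal_span_singleton_smul, smul_eq_mul, Ideal.mul_top]
        ).extendScalarsOfSurjective Ideal.Quotient.mk_surjective
    exact (e.isWeaklyRegular_congr _).2 (quot x hxs).2

end RegularSystem

section Koszul

variable {R M : Type*} [CommRing R] [AddCommGroup M] [Module R M]

theorem mem_smul_top_iff_exists_lid_rTensor (I : Ideal R) (m : M) :
    m ∈ (I • ⊤ : Submodule R M) ↔
      ∃ u : I ⊗[R] M, TensorProduct.lid R M (I.subtype.rTensor M u) = m := by
  constructor
  · intro hm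
    refine Submodule.smul_induction_on hm (fun r hr n _ => ⟨⟨r, hr⟩ ⊗ₜ n, by simp⟩) ?_
    rintro _ _ ⟨u, rfl⟩ ⟨v, rfl⟩
    exact ⟨u + v, by simp⟩
  · rintro ⟨u, rfl⟩
    induction u with
    | zero => simp
    | tmul i n => simpa using Submodule.smul_mem_smul i.2 (Submodule.mem_top (x := n))
    | add u v hu hv => simpa using add_mem hu hv

/-- Vanishing of `Tor₁(R/I, M)`, expressed as injectivity of `I ⊗ M → M`, is preserved by adding
to `I` an element that is regular on `M/IM`. -/
theorem rTensor_subtype_sup_span_singleton_injective {I : Ideal R} {x : R}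
    (hI : Function.Injective (I.subtype.rTensor M))
    (hx : IsSMulRegular (M ⧸ (I • ⊤ : Submodule R M)) x) :
    Function.Injective ((I ⊔ Ideal.span {x}).subtype.rTensor M) := by
  set J := I ⊔ Ideal.span {x} with hJ
  have hIJ : I ≤ J := le_sup_left
  have hxJ : x ∈ J := Ideal.mem_sup_right (Ideal.mem_span_singleton_self x)
  let ι : I →ₗ[R] J := Submodule.inclusion hIJ
  have hι : ∀ u, J.subtype.rTensor M (ι.rTensor M u) = I.subtype.rTensor M u := fun u => by
    rw [← LinearMap.comp_apply, ← LinearMap.rTensor_comp]; rfl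
  have hdecomp : ∀ t : J ⊗[R] M, ∃ u m, t = ι.rTensor M u + (⟨x, hxJ⟩ : J) ⊗ₜ[R] m := by
    intro t
    induction t with
    | zero => exact ⟨0, 0, by simp⟩
    | tmul y m =>
      obtain ⟨y, hy⟩ := y
      obtain ⟨i, hi, w, hw, rfl⟩ := Submodule.mem_sup.1 hy
      obtain ⟨r, rfl⟩ := Ideal.mem_span_singleton'.1 hw
      refine ⟨⟨i, hi⟩ ⊗ₜ m, r • m, ?_⟩
      rw [LinearMap.rTensor_tmul, ← TensorProduct.smul_tmul, ← TensorProduct.add_tmul]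
      rfl
    | add s t hs ht =>
      obtain ⟨u, m, rfl⟩ := hs
      obtain ⟨v, n, rfl⟩ := ht
      exact ⟨u + v, m + n, by rw [map_add, TensorProduct.tmul_add]; abel⟩
  have hswap : ∀ w : I ⊗[R] M, (⟨x, hxJ⟩ : J) ⊗ₜ[R] TensorProduct.lid R M (I.subtype.rTensor M w)
      = ι.rTensor M (x • w) := by
    intro w
    induction w with
    | zero => simp
    | tmul i m =>
      simp only [LinearMap.rTensor_tmul, TensorProduct.lid_tmul, ← TensorProduct.smul_tmul,
        TensorProduct.smul_tmul']
      congr 1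
      exact Subtype.ext (mul_comm _ _)
    | add s t hs ht => simp only [map_add, TensorProduct.tmul_add, smul_add, hs, ht]
  rw [← LinearMap.ker_eq_bot, LinearMap.ker_eq_bot']
  intro t ht
  obtain ⟨u, m, rfl⟩ := hdecomp t
  have h0 := congrArg (TensorProduct.lid R M) ht
  rw [map_add, hι, map_add, map_zero, LinearMap.rTensor_tmul, TensorProduct.lid_tmul] at h0
  have hm : m ∈ (I • ⊤ : Submodule R M) := by
    refine mem_of_isSMulRegular_quotient_of_smul_mem hx ?_
    rw [show x • m = -_ from eq_neg_of_add_eq_zero_right h0]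
    exact neg_mem ((mem_smul_top_iff_exists_lid_rTensor I _).2 ⟨u, rfl⟩)
  obtain ⟨w, rfl⟩ := (mem_smul_top_iff_exists_lid_rTensor I m).1 hm
  rw [hswap, ← map_add] at ht ⊢
  rw [hι, ← map_zero (I.subtype.rTensor M)] at ht
  rw [hI ht, map_zero]

theorem RingTheory.Sequence.IsWeaklyRegular.rTensor_subtype_injective {rs : List R}
    (h : IsWeaklyRegular M rs) : Function.Injective ((Ideal.ofList rs).subtype.rTensor M) := by
  induction rs using List.reverseRecOn with
  | nil =>
    rw [Ideal.ofList_nil]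
    have : Subsingleton ((⊥ : Ideal R) ⊗[R] M) := inferInstance
    exact Function.injective_of_subsingleton _
  | append_singleton rs r ih =>
    rw [isWeaklyRegular_append_iff, isWeaklyRegular_singleton_iff] at h
    rw [Ideal.ofList_append, Ideal.ofList_singleton]
    exact rTensor_subtype_sup_span_singleton_injective (ih h.1) h.2

end Koszul

section Powers

variable {R : Type*} [CommRing R]

theorem RingTheory.Sequence.IsWeaklyRegular.of_exact {rs : List R} :
    ∀ {A B C : Type*} [AddCommGroup A] [AddCommGroup B] [AddCommGroup C]
      [Module R A] [Module R B] [Module R C] {f : A →ₗ[R] B} {g : B →ₗ[R] C},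
      Function.Injective f → Function.Exact f g → Function.Surjective g →
      IsWeaklyRegular A rs → IsWeaklyRegular C rs → IsWeaklyRegular B rs := by
  induction rs with
  | nil => intros; exact .nil R _
  | cons r rs ih =>
    intro A B C _ _ _ _ _ _ f g hf hfg hg hA hC
    rw [isWeaklyRegular_cons_iff] at hA hC ⊢
    refine ⟨isSMulRegular_of_range_eq_ker hf hfg.linearMap_ker_eq.symm hA.1 hC.1, ?_⟩
    refine ih (f := QuotSMulTop.map r f) (g := QuotSMulTop.map r g) ?_
      (QuotSMulTop.map_exact r hfg hg) (QuotSMulTop.map_surjective r hg) hA.2 hC.2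
    rw [← LinearMap.exact_zero_iff_injective (QuotSMulTop r PUnit)]
    have h0 : Function.Exact (0 : PUnit →ₗ[R] A) f :=
      (LinearMap.exact_zero_iff_injective _ f).2 hf
    have := QuotSMulTop.map_first_exact_on_four_term_exact_of_isSMulRegular_last h0 hfg hC.1
    rwa [map_zero] at this

variable {M : Type*} [AddCommGroup M] [Module R M]

open Pointwise in
theorem RingTheory.Sequence.IsWeaklyRegular.quotSMulTop_pow {x : R} {rs : List R}
    (h : IsWeaklyRegular M (x :: rs)) (a : ℕ) :
    IsWeaklyRegular (QuotSMulTop (x ^ (a + 1)) M) rs := by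
  rw [isWeaklyRegular_cons_iff] at h
  induction a with
  | zero =>
    rw [zero_add, pow_one]
    exact h.2
  | succ a ih =>
    have hx := h.1.pow (a + 1)
    let f : QuotSMulTop x M →ₗ[R] QuotSMulTop (x ^ (a + 2)) M :=
      Submodule.mapQ _ _ (LinearMap.lsmul R M (x ^ (a + 1))) <| by
        rintro _ ⟨m, -, rfl⟩
        exact ⟨m, trivial, by simp [smul_smul, pow_succ, mul_comm]⟩
    let g : QuotSMulTop (x ^ (a + 2)) M →ₗ[R] QuotSMulTop (x ^ (a + 1)) M :=
      Submodule.mapQ _ _ LinearMap.id <| by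
        rintro _ ⟨m, -, rfl⟩
        exact ⟨x • m, trivial, by simp [smul_smul, pow_succ, mul_comm]⟩
    refine .of_exact (f := f) (g := g) ?_ ?_ ?_ h.2 ih
    · rw [← LinearMap.ker_eq_bot, LinearMap.ker_eq_bot']
      intro m hm
      obtain ⟨m, rfl⟩ := Submodule.mkQ_surjective _ m
      obtain ⟨n, -, hn⟩ := (Submodule.Quotient.mk_eq_zero _).1 hm
      refine (Submodule.Quotient.mk_eq_zero _).2 ⟨n, trivial, hx ?_⟩
      simpa [smul_smul, pow_succ] using hn
    · intro m
      obtain ⟨m, rfl⟩ := Submodule.mkQ_surjective _ m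
      constructor
      · intro hm
        obtain ⟨n, -, hn⟩ := (Submodule.Quotient.mk_eq_zero _).1 hm
        exact ⟨Submodule.Quotient.mk n, congrArg Submodule.Quotient.mk hn⟩
      · rintro ⟨n, hn⟩
        obtain ⟨n, rfl⟩ := Submodule.mkQ_surjective _ n
        rw [← hn]
        exact (Submodule.Quotient.mk_eq_zero _).2 ⟨n, trivial, rfl⟩
    · intro m
      obtain ⟨m, rfl⟩ := Submodule.mkQ_surjective _ m
      exact ⟨Submodule.Quotient.mk m, rfl⟩

theorem RingTheory.Sequence.IsWeaklyRegular.map_pow {rs : List R} {a : ℕ} (ha : a ≠ 0) :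
    ∀ {M : Type*} [AddCommGroup M] [Module R M], IsWeaklyRegular M rs →
      IsWeaklyRegular M (rs.map (· ^ a)) := by
  obtain ⟨a, rfl⟩ := Nat.exists_eq_succ_of_ne_zero ha
  induction rs with
  | nil => intros; exact .nil R _
  | cons r rs ih =>
    intro M _ _ h
    exact .cons (((isWeaklyRegular_cons_iff M r rs).1 h).1.pow _) (ih (h.quotSMulTop_pow a))

end Powers

section Free

variable {R S : Type*} [CommRing R] [CommRing S]

theorem Ideal.mem_map_algebraMap_of_algebraMap_mul_mem [Algebra R S] [Module.Free R S]
    {J K : Ideal R} {f : R} (hJK : ∀ r, r * f ∈ J → r ∈ K) {s : S}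
    (hs : algebraMap R S f * s ∈ J.map (algebraMap R S)) : s ∈ K.map (algebraMap R S) := by
  let b := Module.Free.chooseBasis R S
  have hrepr : ∀ y ∈ J.map (algebraMap R S), ∀ i, b.repr y i ∈ J := by
    intro y hy i
    have hy' : y ∈ (J • ⊤ : Submodule R S) := by rwa [Ideal.smul_top_eq_map]
    refine Submodule.smul_induction_on hy' (fun r hr n _ => ?_) fun y z hy hz => ?_
    · simpa using J.mul_mem_right _ hr
    · simpa using add_mem hy hz
  rw [← b.linearCombination_repr s, Finsupp.linearCombination_apply]
  refine Submodule.sum_mem _ fun i _ => ?_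
  have hi : b.repr s i ∈ K := hJK _ <| by
    have := hrepr _ hs i
    rw [← Algebra.smul_def] at this
    simpa [mul_comm] using this
  simp only [Algebra.smul_def]
  exact Ideal.mul_mem_right _ _ (Ideal.mem_map_of_mem _ hi)

/-- A finite ring homomorphism out of a Noetherian local ring whose maximal ideal is generated by
a sequence with weakly regular image is free. -/
theorem Module.Free.of_isWeaklyRegular_map [IsLocalRing R] [IsNoetherianRing R] [Algebra R S]
    [Module.Finite R S] {xs : List R} (hxs : Ideal.ofList xs = maximalIdeal R)
    (h : IsWeaklyRegular S (xs.map (algebraMap R S))) : Module.Free R S := by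
  have := Module.finitePresentation_of_finite R S
  refine Module.free_of_maximalIdeal_rTensor_injective ?_
  rw [← hxs]
  exact ((isWeaklyRegular_map_algebraMap_iff S S xs).1 h).rTensor_subtype_injective

end Free

section Frobenius

variable {R : Type*} [CommRing R] (p : ℕ)

theorem FFinite.finite_frobenius [ExpChar R p] (h : FFinite R p) : (frobenius R p).Finite := by
  have hrange : ∀ x, frobenius R p x ∈ pthPowers R p := fun x =>
    Subring.subset_closure ⟨x, rfl⟩
  have hsurj : Function.Surjective ((frobenius R p).codRestrict (pthPowers R p) hrange) := by
    rintro ⟨y, hy⟩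
    have hle : pthPowers R p ≤ (frobenius R p).range := by
      refine Subring.closure_le.2 ?_
      rintro _ ⟨x, rfl⟩
      exact ⟨x, rfl⟩
    obtain ⟨x, hx⟩ := hle hy
    exact ⟨x, Subtype.ext hx⟩
  have hsub : (pthPowers R p).subtype.Finite := h
  exact hsub.comp (.of_surjective _ hsurj)

variable [ExpChar R p]

theorem frobeniusPower_pow_eq_map (J : Ideal R) (e : ℕ) :
    frobeniusPower J (p ^ e) = J.map (iterateFrobenius R p e) := rfl

/-- For a regular system of parameters, Frobenius is flat; this is the resulting behaviour of
colon ideals. -/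
theorem mem_map_frobenius_of_frobenius_mul_mem [IsLocalRing R] [IsNoetherianRing R]
    (hfin : (frobenius R p).Finite) {xs : List R} (hxs : Ideal.ofList xs = maximalIdeal R)
    (hreg : IsWeaklyRegular R xs) {J K : Ideal R} {f : R} (hJK : ∀ r, r * f ∈ J → r ∈ K) {s : R}
    (hs : frobenius R p f * s ∈ J.map (frobenius R p)) : s ∈ K.map (frobenius R p) := by
  have free : ∀ {S : Type _} [CommRing S] (φ : R →+* S), φ.Finite → IsWeaklyRegular S (xs.map φ) →
      ∀ s, φ f * s ∈ J.map φ → s ∈ K.map φ := by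
    intro S _ φ hφ hx s hs
    algebraize [φ]
    have := Module.Free.of_isWeaklyRegular_map hxs hx
    exact Ideal.mem_map_algebraMap_of_algebraMap_mul_mem hJK hs
  exact free _ hfin (hreg.map_pow (expChar_ne_zero R p)) s hs

theorem mem_map_iterateFrobenius_of_iterateFrobenius_mul_mem [IsLocalRing R] [IsNoetherianRing R]
    (hfin : (frobenius R p).Finite) {xs : List R} (hxs : Ideal.ofList xs = maximalIdeal R)
    (hreg : IsWeaklyRegular R xs) {J K : Ideal R} {f : R} (hJK : ∀ r, r * f ∈ J → r ∈ K) (k : ℕ)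
    {s : R} (hs : iterateFrobenius R p k f * s ∈ J.map (iterateFrobenius R p k)) :
    s ∈ K.map (iterateFrobenius R p k) := by
  induction k generalizing s with
  | zero => simpa [iterateFrobenius_zero, mul_comm] using hJK s (by simpa [mul_comm] using hs)
  | succ k ih =>
    have hcomp : iterateFrobenius R p (k + 1) = (frobenius R p).comp (iterateFrobenius R p k) := by
      rw [add_comm, iterateFrobenius_add, iterateFrobenius_one]
    rw [hcomp, ← Ideal.map_map] at hs ⊢
    exact mem_map_frobenius_of_frobenius_mul_mem p hfin hxs hreg
      (fun r hr => ih (by rwa [mul_comm] at hr)) hs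

theorem map_iterateFrobenius_le_pow (J : Ideal R) (k : ℕ) :
    J.map (iterateFrobenius R p k) ≤ J ^ p ^ k := by
  refine Ideal.map_le_iff_le_comap.2 fun x hx => ?_
  rw [Ideal.mem_comap, iterateFrobenius_def]
  exact Ideal.pow_mem_pow hx _

variable {p}

theorem exists_pow_mul_mem_map_iterateFrobenius {I : Ideal R} {e : ℕ} {f : R}
    (hf : ∀ d ∈ I, f * d ∈ I.map (iterateFrobenius R p e)) (k : ℕ) :
    ∃ a : ℕ, (p ^ e - 1) * a + 1 = p ^ (e * k) ∧
      ∀ d ∈ I, f ^ a * d ∈ I.map (iterateFrobenius R p (e * k)) := by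
  have hp : 0 < p ^ e := pow_pos (expChar_pos R p) e
  induction k with
  | zero => exact ⟨0, by simp, fun d hd => by simpa [iterateFrobenius_zero] using hd⟩
  | succ k ih =>
    obtain ⟨a, ha, h⟩ := ih
    refine ⟨1 + p ^ e * a, ?_, fun d hd => ?_⟩
    · rw [mul_add_one e k, pow_add, ← ha]
      obtain ⟨n, hn⟩ := Nat.exists_eq_add_of_lt hp
      simp only [hn, zero_add, Nat.add_sub_cancel]
      ring
    · have hspan : I.map (iterateFrobenius R p e) ≤
          Submodule.comap (LinearMap.mulLeft R (iterateFrobenius R p e (f ^ a)))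
            (I.map (iterateFrobenius R p (e * (k + 1)))) := by
        refine Ideal.span_le.2 ?_
        rintro _ ⟨x, hx, rfl⟩
        rw [mul_add_one e k, add_comm, iterateFrobenius_add, ← Ideal.map_map]
        simpa using Ideal.mem_map_of_mem (iterateFrobenius R p e) (h x hx)
      have := hspan (hf d hd)
      simp only [Submodule.mem_comap, LinearMap.mulLeft_apply, iterateFrobenius_def] at this
      convert this using 1
      ring

end Frobenius

section Main

variable {R : Type*} [CommRing R]

theorem UnmixedReducedOfHeight.ne_bot [IsDomain R] {I : Ideal R} {h : ℕ} (hh : 0 < h)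
    (hI : UnmixedReducedOfHeight I h) : I ≠ ⊥ := by
  rintro rfl
  have hbot : (⊥ : Ideal R).IsPrime := Ideal.isPrime_bot
  have h1 := hI.2 ⊥ hbot ⟨⟨hbot, le_rfl⟩, fun _ _ _ => bot_le⟩
  have h2 : primeHeight (⊥ : Ideal R) hbot = 0 :=
    Order.height_eq_zero.2 fun P _ => bot_le (a := P.asIdeal)
  rw [h2] at h1
  exact hh.ne (by exact_mod_cast h1)

theorem mem_pow_of_mul_mem_map_iterateFrobenius [IsLocalRing R] [IsNoetherianRing R] [IsDomain R]
    {p : ℕ} [Fact p.Prime] [ExpChar R p] (hfin : (frobenius R p).Finite) {xs : List R}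
    (hxs : Ideal.ofList xs = maximalIdeal R) (hreg : IsWeaklyRegular R xs) {I : Ideal R}
    (hI : I ≠ ⊥) {e : ℕ} (he : e ≠ 0) {f : R}
    (hf : ∀ d ∈ I, f * d ∈ I.map (iterateFrobenius R p e)) : f ∈ I ^ (p ^ e - 1) := by
  by_contra hfI
  set n := p ^ e - 1 with hn
  obtain ⟨d, hd, hd0⟩ := Submodule.exists_mem_ne_zero_of_ne_bot hI
  refine pow_ne_zero n hd0 ?_
  have hK : ∀ r, r * f ∈ I ^ n → r ∈ maximalIdeal R := fun r hr hu =>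
    hfI ((Ideal.unit_mul_mem_iff_mem _ hu).1 hr)
  have hmem : ∀ k, d ^ n ∈ maximalIdeal R ^ p ^ (e * k) := by
    intro k
    obtain ⟨a, ha, h⟩ := exists_pow_mul_mem_map_iterateFrobenius hf k
    refine map_iterateFrobenius_le_pow p _ _ <|
      mem_map_iterateFrobenius_of_iterateFrobenius_mul_mem p hfin hxs hreg hK (e * k) ?_
    have h1 := Ideal.mul_mem_left _ f (Ideal.pow_mem_pow (h d hd) n)
    rw [← Ideal.map_pow] at h1
    convert h1 using 1
    rw [iterateFrobenius_def, ← ha]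
    ring
  rw [← Submodule.mem_bot R, ← Ideal.iInf_pow_eq_bot_of_isLocalRing (maximalIdeal R)
    (maximalIdeal.isMaximal R).ne_top, Submodule.mem_iInf]
  intro k
  refine Ideal.pow_le_pow_right ?_ (hmem k)
  exact (Nat.le_mul_of_pos_left k (Nat.pos_of_ne_zero he)).trans
    (Nat.lt_pow_self (Fact.out : p.Prime).one_lt).le

end Main

end

/-- for an unmixed reduced ideal `I` of height `h > 0` in an F-finite
regular local ring of characteristic `p`, one has `(I^{[q]} : I) ⊆ I^{q-1}` for every
`q = p^e`. -/
theorem colon_frobeniusPower_le_pow {R : Type*} [CommRing R] [IsLocalRing R] (p : ℕ)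
    [Fact p.Prime] [CharP R p] (hreg : IsRegularLocal R) (hFF : FFinite R p)
    (I : Ideal R) (hIne : I ≠ ⊤) (h : ℕ) (hh : 0 < h)
    (hI : UnmixedReducedOfHeight I h) (e : ℕ) :
    Submodule.colon (frobeniusPower I (p ^ e)) I ≤ I ^ (p ^ e - 1) := by
  have hnoeth := hreg.1
  obtain ⟨s, hs, hcard⟩ := hreg.2
  have hxs : Ideal.ofList s.toList = IsLocalRing.maximalIdeal R := by
    rw [← hs]
    simp only [Ideal.ofList, Finset.mem_toList]
    rfl
  obtain ⟨hdom, hwr⟩ := isDomain_and_isWeaklyRegular_of_ofList_eq_maximalIdeal _ s.toList rfl hxs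
    (by rw [Finset.length_toList]; exact hcard.le)
  have : ExpChar R p := .prime Fact.out
  intro f hf
  rcases eq_or_ne e 0 with rfl | he
  · simp
  · exact mem_pow_of_mul_mem_map_iterateFrobenius (hFF.finite_frobenius p) hxs hwr (hI.ne_bot hh) he
      fun d hd => frobeniusPower_pow_eq_map p I e ▸ Submodule.mem_colon.1 hf d hd
end

section
/- Let k be an F-finite (for example, perfect) field of prime characteristic p > 0, let d ≥ 3 be an integer, let R = k[X₁,…,X_d] be the polynomial ring in d variables, and let I = Σ_{i=1}^d (X₁⋯X_{i−1}X_{i+1}⋯X_d)·R be the ideal generated by the d squarefree monomials of degree d−1. Then the pair (R, I^{d−1}) is not F-pure. -/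
/-- If every monomial of `c` is divisible by some `X i ^ q`, then `c^{1/q} R → R^{1/q}` does
not split. -/
theorem MvPolynomial.not_splitsAlong_of_exists_le {σ K : Type*} [Field K] {q : ℕ}
    {c : MvPolynomial σ K} (hc : ∀ m ∈ c.support, ∃ i, q ≤ m i) :
    ¬ SplitsAlong (MvPolynomial σ K) c q := by
  rintro ⟨φ, hφ, hφc⟩
  have hmon : ∀ m ∈ c.support, constantCoeff (φ (monomial m (c.coeff m))) = 0 := by
    intro m hm
    obtain ⟨i, hi⟩ := hc m hm
    have hle : Finsupp.single i q ≤ m := by simpa using hi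
    rw [← add_tsub_cancel_of_le hle, ← one_mul (c.coeff _), ← monomial_mul,
      ← X_pow_eq_monomial, hφ]
    simp
  have h : constantCoeff (φ c) = 0 := by
    conv_lhs => rw [c.as_sum]
    rw [map_sum, map_sum]
    exact Finset.sum_eq_zero hmon
  simp [hφc] at h

/-- A polynomial in `d` variables all of whose monomials have degree greater than `d (q - 1)`
does not split. -/
theorem MvPolynomial.not_splitsAlong_of_mem_pow_idealOfVars {σ K : Type*} [Fintype σ] [Field K]
    {q n : ℕ} (hn : Fintype.card σ * (q - 1) < n) {c : MvPolynomial σ K}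
    (hc : c ∈ idealOfVars σ K ^ n) : ¬ SplitsAlong (MvPolynomial σ K) c q := by
  refine not_splitsAlong_of_exists_le fun m hm => ?_
  by_contra! hlt
  have hdeg : n ≤ m.degree := (mem_pow_idealOfVars_iff n c).mp hc m hm
  have hsum : m.degree ≤ Fintype.card σ * (q - 1) := by
    rw [Finsupp.degree_eq_sum, ← smul_eq_mul, ← Finset.card_univ]
    exact Finset.sum_le_card_nsmul _ _ _ fun i _ => Nat.le_sub_one_of_lt (hlt i)
  omega

/-- The ideal of squarefree monomials of degree `d - 1` lies in the `(d - 1)`-st power of the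
ideal of variables. -/
theorem MvPolynomial.span_squarefree_le_pow_idealOfVars (K : Type*) [Field K] (d : ℕ) :
    Ideal.span (Set.range fun i : Fin d =>
      ∏ j ∈ Finset.univ.erase i, (X j : MvPolynomial (Fin d) K)) ≤
      idealOfVars (Fin d) K ^ (d - 1) := by
  rw [Ideal.span_le]
  rintro _ ⟨i, rfl⟩
  have h := Ideal.prod_mem_prod (s := Finset.univ.erase i) (I := fun _ => idealOfVars (Fin d) K)
    (x := fun j => (X j : MvPolynomial (Fin d) K)) fun j _ => Ideal.subset_span ⟨j, rfl⟩
  simpa using h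

/-- for the ideal `I` generated by the `d` squarefree monomials of
degree `d-1` in a polynomial ring in `d ≥ 3` variables over an F-finite field of
characteristic `p > 0`, the pair `(R, I^{d-1})` is not F-pure. -/
theorem not_fPurePair_squarefree_monomials (p : ℕ) [Fact p.Prime]
    (K : Type*) [Field K] [CharP K p] (hFF : FFinite K p)
    (d : ℕ) (hd : 3 ≤ d) :
    ¬ FPurePair (MvPolynomial (Fin d) K) p
        (fun _ : Fin 1 => Ideal.span (Set.range fun i : Fin d =>
          ∏ j ∈ Finset.univ.erase i, MvPolynomial.X j))
        (fun _ => (d : ℝ) - 1) := by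
  rintro ⟨e₀, he⟩
  obtain ⟨c, hc, hsplit⟩ := he (e₀ + 1) (Nat.le_succ e₀)
  have hq : 1 < p ^ (e₀ + 1) := Nat.one_lt_pow (Nat.succ_ne_zero _) (Fact.out : p.Prime).one_lt
  have hfloor : ⌊((d : ℝ) - 1) * ((p : ℝ) ^ (e₀ + 1) - 1)⌋₊ = (d - 1) * (p ^ (e₀ + 1) - 1) := by
    have h : ((d : ℝ) - 1) * ((p : ℝ) ^ (e₀ + 1) - 1) =
        (((d - 1) * (p ^ (e₀ + 1) - 1) : ℕ) : ℝ) := by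
      push_cast [Nat.cast_sub (show 1 ≤ d by omega), Nat.cast_sub hq.le]
      rfl
    rw [h, Nat.floor_natCast]
  rw [Fin.prod_univ_one, hfloor] at hc
  have hmem := Ideal.pow_right_mono
    (MvPolynomial.span_squarefree_le_pow_idealOfVars K d) _ hc
  rw [← pow_mul, ← mul_assoc] at hmem
  refine MvPolynomial.not_splitsAlong_of_mem_pow_idealOfVars ?_ hmem hsplit
  rw [Fintype.card_fin]
  refine Nat.mul_lt_mul_of_pos_right ?_ (Nat.sub_pos_of_lt hq)
  obtain ⟨k, rfl⟩ := Nat.exists_eq_add_of_le hd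
  rw [show 3 + k - 1 = 2 + k by omega]
  nlinarith
end
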